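/- arXiv:2003.01983 — 3 statements merged into one kernel-verified Lean document; each statement's English description precedes it below -/
import Mathlib

section
/- Let B be a finite left brace, let B_1, …, B_k be the Sylow subgroups of the additive group (B,+) with B_1 the Sylow p_1-subgroup, and let N be a normal subgroup of the multiplicative group (B,·) with N ⊆ B_1. Then λ_n(b) = b for every n ∈ N and every b ∈ B_i with i ≥ 2; that is, λ_n restricted to B_2 ⊕ ⋯ ⊕ B_k is the identity. -/
/-- The lambda map of a left brace: `λ_a(b) = a·b − a`. -/
def lambdaMap {B : Type*} [AddCommGroup B] [Group B] (a : B) : B → B := fun b => a * b - a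

/-- The left brace axiom: `(B,+)` abelian group, `(B,·)` group, and
`a·(b+c) + a = a·b + a·c`. -/
def IsLeftBrace (B : Type*) [AddCommGroup B] [Group B] : Prop :=
  ∀ a b c : B, a * (b + c) + a = a * b + a * c

/-- In a left brace, `λ_a` is an endomorphism of the additive group. -/
def IsLeftBrace.lambdaHom {B : Type*} [AddCommGroup B] [Group B] (hB : IsLeftBrace B) (a : B) :
    B →+ B :=
  AddMonoidHom.mk' (lambdaMap a) fun b c => by
    have h := eq_sub_of_add_eq (hB a b c)
    simp only [lambdaMap, h]
    abel

theorem IsLeftBrace.nsmul_lambdaMap_eq_zero {B : Type*} [AddCommGroup B] [Group B]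
    (hB : IsLeftBrace B) (a : B) {b : B} {k : ℕ} (hb : k • b = 0) :
    k • lambdaMap a b = 0 := by
  have h := map_nsmul (hB.lambdaHom a) k b
  rw [hb, map_zero] at h
  exact h.symm

theorem IsPGroup.exists_pow_nsmul_eq_zero {B : Type*} [AddCommGroup B] {p : ℕ}
    {H : Subgroup (Multiplicative B)} (hH : IsPGroup p H) {b : B}
    (hb : Multiplicative.ofAdd b ∈ H) : ∃ k : ℕ, p ^ k • b = 0 := by
  obtain ⟨k, hk⟩ := hH ⟨_, hb⟩
  exact ⟨k, congrArg (fun x : H => Multiplicative.toAdd (x : Multiplicative B)) hk⟩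

/-- let `B` be a finite left brace, `P` the Sylow `p`-subgroup of the
additive group `(B,+)`, and `N` a normal subgroup of `(B,·)` with `N ⊆ P`.  Then
`λ_n(b) = b` for every `n ∈ N` and every `b` in the Sylow `q`-subgroup of `(B,+)`
for any prime `q ≠ p` (i.e. `λ_n` restricted to `B_2 ⊕ ⋯ ⊕ B_k` is the identity). -/
theorem lambda_fixes_other_sylows {B : Type*} [Fintype B] [AddCommGroup B] [Group B]
    (hbrace : IsLeftBrace B) (p : ℕ) (hp : p.Prime)
    (P : Sylow p (Multiplicative B))
    (N : Subgroup B) (hnorm : N.Normal)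
    (hNP : ∀ n ∈ N, Multiplicative.ofAdd n ∈ (P : Subgroup (Multiplicative B)))
    (q : ℕ) (hq : q.Prime) (hqp : q ≠ p) (Q : Sylow q (Multiplicative B)) :
    ∀ n ∈ N, ∀ b : B, Multiplicative.ofAdd b ∈ (Q : Subgroup (Multiplicative B)) →
      lambdaMap n b = b := by
  intro n hn b hb
  have hm : b⁻¹ * n * b ∈ N := by simpa using hnorm.conj_mem n hn b⁻¹
  obtain ⟨i, hi⟩ := P.isPGroup'.exists_pow_nsmul_eq_zero (hNP n hn)
  obtain ⟨j, hj⟩ := P.isPGroup'.exists_pow_nsmul_eq_zero (hNP _ hm)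
  obtain ⟨k, hk⟩ := Q.isPGroup'.exists_pow_nsmul_eq_zero hb
  have hdiff : lambdaMap n b - b = lambdaMap b (b⁻¹ * n * b) - n := by
    have h : b * (b⁻¹ * n * b) = n * b := by group
    simp only [lambdaMap, h]
    abel
  have hQ : q ^ k • (lambdaMap n b - b) = 0 := by
    rw [nsmul_sub, hbrace.nsmul_lambdaMap_eq_zero n hk, hk, sub_zero]
  have hP : p ^ (i + j) • (lambdaMap n b - b) = 0 := by
    rw [hdiff, nsmul_sub, pow_add, mul_nsmul', mul_nsmul,
      hbrace.nsmul_lambdaMap_eq_zero b hj, hi, nsmul_zero, nsmul_zero, sub_zero]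
  have hcop : Nat.Coprime (q ^ k) (p ^ (i + j)) :=
    Nat.Coprime.pow _ _ ((Nat.coprime_primes hq hp).2 hqp)
  have hone := Nat.eq_one_of_dvd_coprimes hcop
    (addOrderOf_dvd_of_nsmul_eq_zero hQ) (addOrderOf_dvd_of_nsmul_eq_zero hP)
  exact sub_eq_zero.1 (AddMonoid.addOrderOf_eq_one_iff.1 hone)
end

section
/- Let (X,r) be a finite irretractable involutive non-degenerate set-theoretic solution of the Yang–Baxter equation, let 𝒢 = 𝒢(X,r) with its natural left brace structure and associated solution (𝒢, r_𝒢), and let X̂ = {σ_x | x ∈ X}. Let φ' : X → X̂ be the bijection φ'(x) = σ_x, and let φ̃ : 𝒢 → 𝒢(𝒢, r_𝒢) be defined by φ̃(g) = λ_g. Then φ̃ is a group isomorphism and φ'(g(x)) = φ̃(g)(φ'(x)) for all x ∈ X and g ∈ 𝒢; that is, (φ', φ̃) is a permutational isomorphism from the action of 𝒢 on X to the action of 𝒢(𝒢, r_𝒢) on X̂ ⊆ 𝒢. -/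
/-- The map `σ_x : y ↦` first component of `r(x,y)`. -/
def sigmaMap {X : Type*} (r : X × X → X × X) (x : X) : X → X := fun y => (r (x, y)).1

/-- The map `γ_y : x ↦` second component of `r(x,y)`. -/
def gammaMap {X : Type*} (r : X × X → X × X) (y : X) : X → X := fun x => (r (x, y)).2

/-- `r₁₂ = r × id` on `X³`. -/
def rMap12 {X : Type*} (r : X × X → X × X) : X × X × X → X × X × X :=
  fun p => ((r (p.1, p.2.1)).1, (r (p.1, p.2.1)).2, p.2.2)

/-- `r₂₃ = id × r` on `X³`. -/
def rMap23 {X : Type*} (r : X × X → X × X) : X × X × X → X × X × X :=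
  fun p => (p.1, r p.2)

/-- `(X, r)` is an involutive non-degenerate set-theoretic solution of the
Yang–Baxter equation: `r² = id`, all `σ_x` and `γ_y` are bijective, and
`r₁₂ r₂₃ r₁₂ = r₂₃ r₁₂ r₂₃`. -/
def IsYBSolution {X : Type*} (r : X × X → X × X) : Prop :=
  (∀ p, r (r p) = p) ∧
  (∀ x, Function.Bijective (sigmaMap r x)) ∧
  (∀ y, Function.Bijective (gammaMap r y)) ∧
  rMap12 r ∘ rMap23 r ∘ rMap12 r = rMap23 r ∘ rMap12 r ∘ rMap23 r

/-- The permutation `σ_x` of `X`, for a solution `(X,r)`. -/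
noncomputable def sigmaPerm {X : Type*} (r : X × X → X × X) (h : IsYBSolution r) (x : X) :
    Equiv.Perm X := Equiv.ofBijective (sigmaMap r x) (h.2.1 x)

/-- The permutation group `𝒢(X,r) = ⟨σ_x ∣ x ∈ X⟩ ≤ Sym_X` of a solution `(X,r)`. -/
noncomputable def permGroup {X : Type*} (r : X × X → X × X) (h : IsYBSolution r) :
    Subgroup (Equiv.Perm X) := Subgroup.closure (Set.range (sigmaPerm r h))

/-- The generator `σ_x` as an element of `𝒢(X,r)`. -/
noncomputable def sigmaEl {X : Type*} (r : X × X → X × X) (h : IsYBSolution r) (x : X) :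
    ↥(permGroup r h) :=
  ⟨sigmaPerm r h x, Subgroup.subset_closure (Set.mem_range_self x)⟩

namespace IsLeftBrace

variable {B : Type*} [AddCommGroup B] [Group B]

theorem mul_zero_eq (hB : IsLeftBrace B) (a : B) : a * (0 : B) = a := by
  have h := hB a 0 0
  rw [add_zero] at h
  exact (add_left_cancel h).symm

theorem one_eq_zero (hB : IsLeftBrace B) : (1 : B) = 0 := by
  rw [← hB.mul_zero_eq 1, one_mul]

theorem lambdaMap_one (hB : IsLeftBrace B) (b : B) : lambdaMap 1 b = b := by
  rw [lambdaMap, one_mul, hB.one_eq_zero, sub_zero]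

theorem lambdaMap_mul (hB : IsLeftBrace B) (a b c : B) :
    lambdaMap (a * b) c = lambdaMap a (lambdaMap b c) := by
  have h := hB a (b * c - b) b
  rw [sub_add_cancel] at h
  simp only [lambdaMap]
  rw [sub_eq_sub_iff_add_eq_add, mul_assoc, h]

theorem lambdaMap_inv_lambdaMap (hB : IsLeftBrace B) (a b : B) :
    lambdaMap a⁻¹ (lambdaMap a b) = b := by
  rw [← hB.lambdaMap_mul, inv_mul_cancel, hB.lambdaMap_one]

theorem lambdaMap_lambdaMap_inv (hB : IsLeftBrace B) (a b : B) :
    lambdaMap a (lambdaMap a⁻¹ b) = b := by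
  rw [← hB.lambdaMap_mul, mul_inv_cancel, hB.lambdaMap_one]

theorem lambdaMap_bijective (hB : IsLeftBrace B) (a : B) : Function.Bijective (lambdaMap a) :=
  Function.bijective_iff_has_inverse.mpr
    ⟨lambdaMap a⁻¹, hB.lambdaMap_inv_lambdaMap a, hB.lambdaMap_lambdaMap_inv a⟩

end IsLeftBrace

theorem sigmaEl_injective {X : Type*} (r : X × X → X × X) (h : IsYBSolution r)
    (hirr : ∀ x y : X, x ≠ y → sigmaMap r x ≠ sigmaMap r y) :
    Function.Injective (sigmaEl r h) := by
  intro x y hxy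
  by_contra hne
  exact hirr x y hne (congrArg (fun g : permGroup r h => ⇑(g : Equiv.Perm X)) hxy)

theorem lambdaMap_sigmaEl {X : Type*} (r : X × X → X × X) (h : IsYBSolution r)
    [AddCommGroup ↥(permGroup r h)] (hbrace : IsLeftBrace ↥(permGroup r h))
    (hgen : ∀ x y : X,
      lambdaMap (sigmaEl r h x) (sigmaEl r h y) = sigmaEl r h (sigmaMap r x y))
    (g : ↥(permGroup r h)) (x : X) :
    lambdaMap g (sigmaEl r h x) = sigmaEl r h ((g : Equiv.Perm X) x) := by
  obtain ⟨g, hg⟩ := g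
  induction hg using Subgroup.closure_induction generalizing x with
  | mem g hg =>
    obtain ⟨y, rfl⟩ := hg
    exact hgen y x
  | one => exact hbrace.lambdaMap_one _
  | mul a b ha hb iha ihb =>
    have hab := hbrace.lambdaMap_mul ⟨a, ha⟩ ⟨b, hb⟩ (sigmaEl r h x)
    rw [ihb, iha] at hab
    exact hab
  | inv a ha iha =>
    have hinv := hbrace.lambdaMap_inv_lambdaMap ⟨a, ha⟩ (sigmaEl r h (a⁻¹ x))
    rw [iha, show a (a⁻¹ x) = x from a.apply_symm_apply x] at hinv
    exact hinv

/-- let `(X,r)` be a finite irretractable solution of the YBE and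
`𝒢 = 𝒢(X,r)` with its natural left brace structure and associated solution
`(𝒢, r_𝒢)` (whose permutations are `σ_g = λ_g`, so that
`𝒢(𝒢, r_𝒢) = ⟨λ_g ∣ g ∈ 𝒢⟩`).  Then `φ̃ : g ↦ λ_g` is a group isomorphism from
`𝒢` onto the permutation group `𝒢(𝒢, r_𝒢)` (each `λ_g` is a bijection of `𝒢`,
`φ̃` is multiplicative and injective, and its image generates `𝒢(𝒢, r_𝒢)`), and
together with the bijection `φ' : x ↦ σ_x` from `X` to `X̂ = {σ_x ∣ x ∈ X}` it
satisfies `φ'(g(x)) = φ̃(g)(φ'(x))`; i.e. `(φ', φ̃)` is a permutational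
isomorphism from `𝒢` acting on `X` to `𝒢(𝒢, r_𝒢)` acting on `X̂`. -/
theorem permutational_isomorphism_of_irretractable {X : Type*} [Finite X]
    (r : X × X → X × X) (h : IsYBSolution r)
    (hirr : ∀ x y : X, x ≠ y → sigmaMap r x ≠ sigmaMap r y)
    [AddCommGroup ↥(permGroup r h)] (hbrace : IsLeftBrace ↥(permGroup r h))
    (hgen : ∀ x y : X,
      lambdaMap (sigmaEl r h x) (sigmaEl r h y) = sigmaEl r h (sigmaMap r x y)) :
    (∀ g : ↥(permGroup r h), Function.Bijective (lambdaMap g)) ∧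
    (∀ g₁ g₂ : ↥(permGroup r h), lambdaMap (g₁ * g₂) = lambdaMap g₁ ∘ lambdaMap g₂) ∧
    Function.Injective (fun g : ↥(permGroup r h) => lambdaMap g) ∧
    (∀ (g : ↥(permGroup r h)) (x : X),
      lambdaMap g (sigmaEl r h x) = sigmaEl r h ((g : Equiv.Perm X) x)) := by
  have hact := lambdaMap_sigmaEl r h hbrace hgen
  refine ⟨hbrace.lambdaMap_bijective, fun a b => funext (hbrace.lambdaMap_mul a b), ?_, hact⟩
  intro a b hab
  refine Subtype.ext (Equiv.ext fun x => sigmaEl_injective r h hirr ?_)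
  rw [← hact a x, ← hact b x]
  exact congrFun hab _
end

section
/- Let (X,r) be a finite primitive involutive non-degenerate set-theoretic solution of the Yang–Baxter equation with |X| > 1. Then σ_x = σ_y for all x, y ∈ X, and σ_x is a cycle of length |X| (so (X,r) is the permutation solution r(x,y) = (σ(y), σ^{-1}(x)) determined by a cycle σ of length |X|). -/
/-- A group `G` acts primitively on `X` if the action is transitive and every
block of the action is trivial (a subsingleton or all of `X`). -/
def IsPrimitiveAction (G : Type*) (X : Type*) [Group G] [MulAction G X] : Prop :=
  MulAction.IsPretransitive G X ∧ ∀ B : Set X, MulAction.IsBlock G B → MulAction.IsTrivialBlock B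

/-- A finite solution `(X,r)` is primitive if `𝒢(X,r)` acts primitively on `X`. -/
noncomputable def IsPrimitiveSolution {X : Type*} (r : X × X → X × X) (h : IsYBSolution r) : Prop :=
  IsPrimitiveAction ↥(permGroup r h) X

/-- If the average of finitely many complex roots of unity is a nonzero algebraic integer, then
these roots of unity are all equal. -/
theorem eq_avg_of_isIntegral_avg {m : ℕ} (hm : 0 < m) {s : Multiset ℂ} (hs : 0 < s.card)
    (hroot : ∀ z ∈ s, z ^ m = 1) (hIntegral : IsIntegral ℤ (s.sum / s.card)) (h0 : s.sum ≠ 0) :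
    ∀ z ∈ s, z = s.sum / s.card := by
  set S : Set ℂ := {z | z ^ m = 1} with hS
  have hSfin : Finite S := by
    have : S ⊆ ((Polynomial.X ^ m - 1 : Polynomial ℂ).roots.toFinset : Set ℂ) := by
      intro z hz
      have hz' : z ^ m = 1 := hz
      have hne : (Polynomial.X ^ m - 1 : Polynomial ℂ) ≠ 0 :=
        (Polynomial.monic_X_pow_sub_C 1 hm.ne').ne_zero
      simp [hne, hz']
    exact (Finset.finite_toSet _).subset this
  have hSint : ∀ z ∈ S, IsIntegral ℚ z := fun z hz =>
    ⟨Polynomial.X ^ m - 1, Polynomial.monic_X_pow_sub_C 1 hm.ne', by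
      have hz' : z ^ m = 1 := hz
      simp [hz']⟩
  set L := IntermediateField.adjoin ℚ S
  have hfd : FiniteDimensional ℚ L := IntermediateField.finiteDimensional_adjoin hSint
  have : NumberField L := ⟨⟩
  have hmem : ∀ z ∈ s, z ∈ L := fun z hz => IntermediateField.subset_adjoin ℚ S (hroot z hz)
  obtain ⟨t, rfl⟩ : ∃ t : Multiset L, t.map (algebraMap L ℂ) = s :=
    ⟨s.attach.map fun z => ⟨z.1, hmem z.1 z.2⟩, by
      rw [Multiset.map_map]
      exact s.attach_map_val⟩
  have hcard : (0 : ℝ) < t.card := by simpa using hs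
  have htroot : ∀ z ∈ t, z ^ m = 1 := fun z hz => by
    apply (algebraMap L ℂ).injective
    simpa using hroot _ (Multiset.mem_map_of_mem _ hz)
  set a : L := t.sum / t.card with ha
  have hamap : algebraMap L ℂ a = (t.map (algebraMap L ℂ)).sum / (t.map (algebraMap L ℂ)).card := by
    simp [ha, map_multiset_sum]
  have hnorm1 : ∀ φ : L →+* ℂ, ∀ z ∈ t, ‖φ z‖ = 1 := fun φ z hz =>
    Complex.norm_eq_one_of_pow_eq_one (by rw [← map_pow, htroot z hz, map_one]) hm.ne'
  have hnorm : ∀ φ : L →+* ℂ, ‖φ a‖ ≤ 1 := by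
    intro φ
    have h1 : ‖φ t.sum‖ ≤ t.card := by
      rw [map_multiset_sum]
      refine (norm_multiset_sum_le _).trans ?_
      rw [Multiset.map_map]
      have := Multiset.sum_le_card_nsmul (t.map (norm ∘ φ)) 1 (by
        intro x hx
        obtain ⟨z, hz, rfl⟩ := Multiset.mem_map.1 hx
        exact (hnorm1 φ z hz).le)
      simpa using this
    rw [ha, map_div₀, map_natCast, norm_div, Complex.norm_natCast]
    exact div_le_one_of_le₀ h1 hcard.le
  have ha0 : a ≠ 0 := by
    intro h
    rw [h, map_zero, eq_comm, div_eq_zero_iff] at hamap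
    rcases hamap with h | h
    · exact h0 h
    · exact hs.ne' (by exact_mod_cast h)
  have haint : IsIntegral ℤ a := by
    rw [← isIntegral_algebraMap_iff (algebraMap L ℂ).injective, hamap]
    exact hIntegral
  obtain ⟨n, hn, hpow⟩ :=
    NumberField.Embeddings.pow_eq_one_of_norm_le_one L ℂ ha0 haint hnorm
  rw [← hamap]
  set α := algebraMap L ℂ a with hα
  have hα1 : ‖α‖ = 1 :=
    Complex.norm_eq_one_of_pow_eq_one (by rw [← map_pow, hpow, map_one]) hn.ne'
  have hα0 : α ≠ 0 := by
    intro h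
    rw [h, norm_zero] at hα1
    exact zero_ne_one hα1
  have hre_le : ∀ z ∈ t, (algebraMap L ℂ z / α).re ≤ 1 := fun z hz => by
    refine (Complex.re_le_norm _).trans ?_
    rw [norm_div, hnorm1 _ z hz, hα1, div_one]
  have hsum : (t.map fun z => 1 - (algebraMap L ℂ z / α).re).sum = 0 := by
    have h1 : (t.map fun z => algebraMap L ℂ z / α).sum = t.card := by
      have : (t.map (algebraMap L ℂ)).sum = α * t.card := by
        rw [hamap, Multiset.card_map, div_mul_cancel₀]
        exact_mod_cast hcard.ne'
      rw [Multiset.sum_map_div, this, mul_div_cancel_left₀ _ hα0]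
    have h2 : (t.map fun z => (algebraMap L ℂ z / α).re).sum = t.card := by
      have := congrArg Complex.reAddGroupHom h1
      rw [map_multiset_sum, Multiset.map_map] at this
      simpa using this
    rw [Multiset.sum_map_sub, h2]
    simp
  intro z hz
  obtain ⟨w, hw, rfl⟩ := Multiset.mem_map.1 hz
  have hre : (algebraMap L ℂ w / α).re = 1 := by
    have := Multiset.all_zero_of_le_zero_le_of_sum_eq_zero
      (Multiset.forall_mem_map_iff.2 fun z hz => sub_nonneg.2 (hre_le z hz)) hsum _
      (Multiset.mem_map_of_mem _ hw)
    exact (sub_eq_zero.1 this).symm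
  have h1 : algebraMap L ℂ w / α = 1 := by
    have hn1 : ‖algebraMap L ℂ w / α‖ = 1 := by rw [norm_div, hnorm1 _ w hw, hα1, div_one]
    have := Complex.sq_norm (algebraMap L ℂ w / α)
    rw [hn1, Complex.normSq_apply, hre] at this
    apply Complex.ext
    · simpa using hre
    · simp only [Complex.one_im]
      nlinarith
  exact (div_eq_one_iff_eq hα0).1 h1

/-- A matrix of finite order whose normalized trace is a nonzero algebraic integer is scalar. -/
theorem Matrix.eq_smul_one_of_isIntegral_trace {d m : ℕ} (hd : 0 < d) (hm : 0 < m)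
    {M : Matrix (Fin d) (Fin d) ℂ} (hM : M ^ m = 1) (hIntegral : IsIntegral ℤ (M.trace / d))
    (h0 : M.trace ≠ 0) : ∃ c : ℂ, M = algebraMap ℂ _ c := by
  have : NeZero d := ⟨hd.ne'⟩
  have hcard : M.charpoly.roots.card = d := by
    rw [← (IsAlgClosed.splits M.charpoly).natDegree_eq_card_roots, Matrix.charpoly_natDegree_eq_dim,
      Fintype.card_fin]
  have htr := Matrix.trace_eq_sum_roots_charpoly M
  have hroot : ∀ z ∈ M.charpoly.roots, z ^ m = 1 := by
    intro z hz
    have h1 : z ∈ spectrum ℂ M :=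
      Matrix.mem_spectrum_iff_isRoot_charpoly.2 (Polynomial.isRoot_of_mem_roots hz)
    have h2 := spectrum.pow_mem_pow M m h1
    rwa [hM, spectrum.one_eq, Set.mem_singleton_iff] at h2
  have heq := eq_avg_of_isIntegral_avg hm (hcard.symm ▸ hd) hroot (by rwa [hcard, ← htr])
    (htr ▸ h0)
  set c := M.charpoly.roots.sum / M.charpoly.roots.card
  have hrep : M.charpoly.roots = Multiset.replicate d c := Multiset.eq_replicate.2 ⟨hcard, heq⟩
  have hchar : M.charpoly = (Polynomial.X - Polynomial.C c) ^ d := by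
    rw [(IsAlgClosed.splits M.charpoly).eq_prod_roots_of_monic (Matrix.charpoly_monic M), hrep]
    simp
  have hsep : (Polynomial.X ^ m - 1 : Polynomial ℂ).Separable :=
    Polynomial.X_pow_sub_one_separable_iff.2 (by exact_mod_cast hm.ne')
  have hdvd : minpoly ℂ M ∣ Polynomial.X ^ m - 1 := minpoly.dvd _ _ (by simp [hM])
  have hdvd' : minpoly ℂ M ∣ Polynomial.X - Polynomial.C c := by
    rw [← (hsep.squarefree.squarefree_of_dvd hdvd).dvd_pow_iff_dvd hd.ne', ← hchar]
    exact Matrix.minpoly_dvd_charpoly M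
  refine ⟨c, ?_⟩
  have := (minpoly.dvd_iff (A := ℂ) (x := M)).1 hdvd'
  simpa [sub_eq_zero] using this

theorem Matrix.isIntegral_trace_of_pow_eq_one {d m : ℕ} (hm : 0 < m)
    {M : Matrix (Fin d) (Fin d) ℂ} (hM : M ^ m = 1) : IsIntegral ℤ M.trace := by
  rw [Matrix.trace_eq_sum_roots_charpoly]
  refine IsIntegral.multiset_sum fun z hz => ?_
  have h1 : z ∈ spectrum ℂ M :=
    Matrix.mem_spectrum_iff_isRoot_charpoly.2 (Polynomial.isRoot_of_mem_roots hz)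
  have h2 := spectrum.pow_mem_pow M m h1
  have : Nontrivial (Matrix (Fin d) (Fin d) ℂ) := by
    by_contra h
    rw [not_nontrivial_iff_subsingleton] at h
    rw [spectrum.of_subsingleton] at h1
    exact h1
  rw [hM, spectrum.one_eq, Set.mem_singleton_iff] at h2
  exact IsIntegral.of_pow hm (h2 ▸ isIntegral_one)

theorem trace_mulLeft_pi_matrix {n : ℕ} (d : Fin n → ℕ)
    (m : Π i, Matrix (Fin (d i)) (Fin (d i)) ℂ) :
    LinearMap.trace ℂ _ (LinearMap.mulLeft ℂ m) = ∑ i, (d i : ℂ) * (m i).trace := by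
  classical
  rw [LinearMap.trace_eq_matrix_trace ℂ
    (Pi.basis fun i => Matrix.stdBasis ℂ (Fin (d i)) (Fin (d i))), Matrix.trace,
    Fintype.sum_sigma]
  refine Finset.sum_congr rfl fun i _ => ?_
  have hentry : ∀ a b : Fin (d i), Matrix.diag (LinearMap.toMatrix
      (Pi.basis fun i => Matrix.stdBasis ℂ (Fin (d i)) (Fin (d i)))
      (Pi.basis fun i => Matrix.stdBasis ℂ (Fin (d i)) (Fin (d i))) (LinearMap.mulLeft ℂ m))
      ⟨i, (a, b)⟩ = m i a a := by
    intro a b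
    rw [Matrix.diag_apply, LinearMap.toMatrix_apply, LinearMap.mulLeft_apply, Pi.basis_repr,
      Pi.basis_apply, Pi.mul_apply, Pi.single_eq_same, Matrix.stdBasis_eq_single]
    simp [Matrix.stdBasis]
  rw [Fintype.sum_prod_type]
  simp_rw [hentry]
  simp [Matrix.trace, Finset.mul_sum]

theorem trace_mulLeft_monoidAlgebra_of {G : Type*} [Group G] [Fintype G] [DecidableEq G] (g : G) :
    LinearMap.trace ℂ _ (LinearMap.mulLeft ℂ (MonoidAlgebra.of ℂ G g)) =
      if g = 1 then (Fintype.card G : ℂ) else 0 := by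
  have hentry : ∀ x : G, Matrix.diag (LinearMap.toMatrix (MonoidAlgebra.basis G ℂ)
      (MonoidAlgebra.basis G ℂ) (LinearMap.mulLeft ℂ (MonoidAlgebra.of ℂ G g))) x =
      if g = 1 then 1 else 0 := by
    intro x
    rw [Matrix.diag_apply, LinearMap.toMatrix_apply, LinearMap.mulLeft_apply]
    simp [MonoidAlgebra.basis, MonoidAlgebra.single_mul_single, Finsupp.single_apply]
  rw [LinearMap.trace_eq_matrix_trace ℂ (MonoidAlgebra.basis G ℂ), Matrix.trace]
  simp_rw [hentry]
  split_ifs <;> simp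

theorem AlgHom.exists_eq_algebraMap_of_forall_commute {R : Type*} [Ring R] [Algebra ℂ R] {d : ℕ}
    {ρ : R →ₐ[ℂ] Matrix (Fin d) (Fin d) ℂ} (hρ : Function.Surjective ρ) {a : R}
    (ha : ∀ b, Commute b a) : ∃ c : ℂ, ρ a = algebraMap ℂ _ c := by
  obtain ⟨c, hc⟩ := Matrix.mem_range_scalar_of_commute_single (M := ρ a) fun i j _ => by
    obtain ⟨b, hb⟩ := hρ (Matrix.single i j 1)
    rw [← hb]
    exact (ha b).map ρ
  exact ⟨c, hc.symm⟩

theorem MonoidAlgebra.commute_sum_of_conj {G : Type*} [Group G] {C : Finset G}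
    (hC : ∀ x y, y ∈ C → x * y * x⁻¹ ∈ C) (b : MonoidAlgebra ℂ G) :
    Commute b (∑ x ∈ C, MonoidAlgebra.of ℂ G x) := by
  induction b using MonoidAlgebra.induction_on with
  | of x =>
    rw [Commute, SemiconjBy, Finset.mul_sum, Finset.sum_mul]
    refine Finset.sum_bij' (fun y _ => x * y * x⁻¹) (fun y _ => x⁻¹ * y * x)
      (fun y hy => hC x y hy) (fun y hy => by simpa using hC x⁻¹ y hy)
      (fun y _ => by group) (fun y _ => by group) (fun y _ => ?_)
    rw [← map_mul, ← map_mul]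
    congr 1
    group
  | add a b ha hb => exact ha.add_left hb
  | smul r a ha => exact ha.smul_left r

/-- The key step of Burnside's theorem: an irreducible representation of a simple group, seen as
a surjective homomorphism from the group algebra, at an element with a conjugacy class of prime
power size. -/
theorem IsSimpleGroup.dvd_or_trace_eq_zero_or_eq_one {G : Type*} [Group G] [Finite G]
    [IsSimpleGroup G] {g : G} (hg : g ∉ Subgroup.center G) {C : Finset G}
    (hC : ∀ x, x ∈ C ↔ IsConj g x) {q k : ℕ} (hq : q.Prime) (hcard : C.card = q ^ k)
    {d : ℕ} (hd : 0 < d) {ρ : MonoidAlgebra ℂ G →ₐ[ℂ] Matrix (Fin d) (Fin d) ℂ}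
    (hρ : Function.Surjective ρ) :
    q ∣ d ∨ (ρ (MonoidAlgebra.of ℂ G g)).trace = 0 ∨ ∀ x, ρ (MonoidAlgebra.of ℂ G x) = 1 := by
  have : NeZero d := ⟨hd.ne'⟩
  rw [or_iff_not_imp_left, or_iff_not_imp_left]
  intro hqd h0
  obtain ⟨ω, hω⟩ := AlgHom.exists_eq_algebraMap_of_forall_commute hρ
    (MonoidAlgebra.commute_sum_of_conj (C := C) fun x y hy =>
      (hC _).2 (((hC y).1 hy).trans (isConj_iff.2 ⟨x, rfl⟩)))
  have hωint : IsIntegral ℤ ω := by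
    rw [← isIntegral_algebraMap_iff (FaithfulSMul.algebraMap_injective ℂ
      (Matrix (Fin d) (Fin d) ℂ)), ← hω]
    let φ : MonoidAlgebra ℤ G →ₐ[ℤ] Matrix (Fin d) (Fin d) ℂ :=
      MonoidAlgebra.lift ℤ _ G (((ρ : MonoidAlgebra ℂ G →* Matrix (Fin d) (Fin d) ℂ)).comp
        (MonoidAlgebra.of ℂ G))
    have h1 : φ (∑ x ∈ C, MonoidAlgebra.of ℤ G x) = ρ (∑ x ∈ C, MonoidAlgebra.of ℂ G x) := by
      simp [φ, map_sum]
    rw [← h1]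
    exact (IsIntegral.of_finite ℤ _).map φ
  have htr : ω * d = q ^ k * (ρ (MonoidAlgebra.of ℂ G g)).trace := by
    have h1 := congrArg Matrix.trace hω
    rw [map_sum, Matrix.trace_sum, Matrix.algebraMap_eq_diagonal] at h1
    rw [Finset.sum_congr rfl (g := fun _ => (ρ (MonoidAlgebra.of ℂ G g)).trace)] at h1
    · simpa [hcard, mul_comm] using h1.symm
    · intro x hx
      obtain ⟨c, rfl⟩ := isConj_iff.1 ((hC x).1 hx)
      rw [map_mul, map_mul, Matrix.trace_mul_comm, ← map_mul, ← map_mul, ← mul_assoc,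
        inv_mul_cancel, one_mul]
  have hpow : ρ (MonoidAlgebra.of ℂ G g) ^ Nat.card G = 1 := by
    rw [← map_pow, ← map_pow, pow_card_eq_one', map_one, map_one]
  have hIntegral := Matrix.isIntegral_trace_of_pow_eq_one Nat.card_pos hpow
  have hIntegral' : IsIntegral ℤ ((ρ (MonoidAlgebra.of ℂ G g)).trace / d) := by
    have hcop : IsCoprime ((q ^ k : ℕ) : ℤ) d :=
      Nat.isCoprime_iff_coprime.2 (((Nat.Prime.coprime_iff_not_dvd hq).2 hqd).pow_left k)
    obtain ⟨u, v, huv⟩ := hcop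
    have huv' : (u : ℂ) * q ^ k + v * d = 1 := by exact_mod_cast huv
    have hd' : (d : ℂ) ≠ 0 := by exact_mod_cast hd.ne'
    have : (ρ (MonoidAlgebra.of ℂ G g)).trace / d =
        u * ω + v * (ρ (MonoidAlgebra.of ℂ G g)).trace := by
      rw [div_eq_iff hd']
      linear_combination (-(ρ (MonoidAlgebra.of ℂ G g)).trace) * huv' - (u : ℂ) * htr
    rw [this]
    have hz : ∀ n : ℤ, IsIntegral ℤ (n : ℂ) := fun n => isIntegral_algebraMap (R := ℤ)
    exact ((hz u).mul hωint).add ((hz v).mul hIntegral)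
  obtain ⟨c, hc⟩ := Matrix.eq_smul_one_of_isIntegral_trace hd Nat.card_pos hpow hIntegral' h0
  let f : G →* Matrix (Fin d) (Fin d) ℂ :=
    (ρ : MonoidAlgebra ℂ G →* Matrix (Fin d) (Fin d) ℂ).comp (MonoidAlgebra.of ℂ G)
  have hf : ∀ x, f x = ρ (MonoidAlgebra.of ℂ G x) := fun _ => rfl
  have hcomm : ∀ x, x * g * x⁻¹ * g⁻¹ ∈ f.ker := by
    intro x
    have hx : f (x * g) = f (g * x) := by
      rw [map_mul, map_mul, hf g, hc]
      exact (Algebra.commutes c (f x)).symm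
    rw [MonoidHom.mem_ker, mul_assoc, map_mul, hx, ← map_mul]
    rw [show g * x * (x⁻¹ * g⁻¹) = 1 by group, map_one]
  rcases IsSimpleGroup.eq_bot_or_eq_top_of_normal f.ker inferInstance with h | h
  · refine absurd (Subgroup.mem_center_iff.2 fun x => ?_) hg
    have := hcomm x
    rw [h, Subgroup.mem_bot, mul_inv_eq_one, mul_inv_eq_iff_eq_mul] at this
    exact this
  · intro x
    rw [← hf, ← MonoidHom.mem_ker, h]
    exact Subgroup.mem_top x

/-- **Burnside**: in a finite simple group, an element whose conjugacy class has prime power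
cardinality is central. -/
theorem IsSimpleGroup.mem_center_of_card_conj_eq_prime_pow {G : Type*} [Group G] [Finite G]
    [IsSimpleGroup G] {g : G} {C : Finset G} (hC : ∀ x, x ∈ C ↔ IsConj g x) {q k : ℕ}
    (hq : q.Prime) (hcard : C.card = q ^ k) : g ∈ Subgroup.center G := by
  classical
  by_contra hg
  have hg1 : g ≠ 1 := by
    rintro rfl
    exact hg (one_mem _)
  have := Fintype.ofFinite G
  obtain ⟨n, d, hd, ⟨e⟩⟩ :=
    IsSemisimpleRing.exists_algEquiv_pi_matrix_of_isAlgClosed ℂ (MonoidAlgebra ℂ G)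
  let ρ : ∀ i, MonoidAlgebra ℂ G →ₐ[ℂ] Matrix (Fin (d i)) (Fin (d i)) ℂ := fun i =>
    (Pi.evalAlgHom ℂ (fun i => Matrix (Fin (d i)) (Fin (d i)) ℂ) i).comp e.toAlgHom
  have hρe : ∀ i a, ρ i a = e a i := fun _ _ => rfl
  have hρ : ∀ i, Function.Surjective (ρ i) := fun i =>
    (Function.surjective_eval i).comp e.surjective
  have key := fun i => IsSimpleGroup.dvd_or_trace_eq_zero_or_eq_one hg hC hq hcard
    (Nat.pos_of_neZero (d i)) (hρ i)
  have htriv : ∀ i, (∀ x, ρ i (MonoidAlgebra.of ℂ G x) = 1) →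
      ∀ a, ∃ c : ℂ, ρ i a = algebraMap ℂ _ c ∧ c = MonoidAlgebra.lift ℂ ℂ G 1 a := by
    intro i hi a
    refine ⟨_, ?_, rfl⟩
    induction a using MonoidAlgebra.induction_on with
    | of x => simpa using hi x
    | add a b ha hb => simp only [map_add, ha, hb]
    | smul r a ha => simp only [map_smul, ha, Algebra.algebraMap_eq_smul_one, smul_eq_mul, mul_smul]
  -- the trivial representation occurs
  obtain ⟨i₀, hi₀⟩ : ∃ i, ∀ x, ρ i (MonoidAlgebra.of ℂ G x) = 1 := by
    set N : MonoidAlgebra ℂ G := ∑ x, MonoidAlgebra.of ℂ G x with hN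
    have hN0 : N ≠ 0 := by
      intro h
      have := congrArg (MonoidAlgebra.lift ℂ ℂ G 1) h
      simp [hN, map_sum] at this
    obtain ⟨i, hi⟩ : ∃ i, ρ i N ≠ 0 := by
      by_contra! h
      exact hN0 (e.injective (by
        rw [map_zero]
        exact funext h))
    refine ⟨i, fun x => ?_⟩
    obtain ⟨c, hc⟩ := AlgHom.exists_eq_algebraMap_of_forall_commute (hρ i)
      (MonoidAlgebra.commute_sum_of_conj (C := (Finset.univ : Finset G)) fun _ _ _ =>
        Finset.mem_univ _)
    have hxN : MonoidAlgebra.of ℂ G x * N = N := by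
      rw [hN, Finset.mul_sum]
      simp_rw [← map_mul]
      exact Fintype.sum_equiv (Equiv.mulLeft x) _ _ fun _ => rfl
    have h1 := congrArg (ρ i) hxN
    have hc0 : c ≠ 0 := by
      rintro rfl
      exact hi (by rw [hN, hc, map_zero])
    rw [map_mul, hN, hc, Algebra.algebraMap_eq_smul_one, mul_smul_comm, mul_one] at h1
    exact smul_right_injective _ hc0 h1
  have hd₀ : d i₀ = 1 := by
    have hsurj : Function.Surjective (algebraMap ℂ (Matrix (Fin (d i₀)) (Fin (d i₀)) ℂ)) := by
      intro M
      obtain ⟨a, rfl⟩ := hρ i₀ M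
      obtain ⟨c, hc, -⟩ := htriv i₀ hi₀ a
      exact ⟨c, hc.symm⟩
    by_contra h1
    have h2 : 1 < d i₀ := by
      have := Nat.pos_of_neZero (d i₀)
      omega
    obtain ⟨c, hc⟩ := hsurj (Matrix.single ⟨0, by omega⟩ ⟨1, h2⟩ 1)
    have := congrFun (congrFun hc ⟨0, by omega⟩) ⟨1, h2⟩
    simp [Matrix.algebraMap_matrix_apply] at this
  have huniq : ∀ i, (∀ x, ρ i (MonoidAlgebra.of ℂ G x) = 1) → i = i₀ := by
    intro i hi
    by_contra hne
    obtain ⟨c, hc, hc'⟩ := htriv i hi (e.symm (Pi.single i₀ 1))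
    obtain ⟨c₀, hc₀, hc₀'⟩ := htriv i₀ hi₀ (e.symm (Pi.single i₀ 1))
    rw [hρe, AlgEquiv.apply_symm_apply, Pi.single_eq_of_ne hne, eq_comm,
      FaithfulSMul.algebraMap_eq_zero_iff] at hc
    rw [hρe, AlgEquiv.apply_symm_apply, Pi.single_eq_same, eq_comm,
      FaithfulSMul.algebraMap_eq_one_iff] at hc₀
    rw [hc] at hc'
    rw [hc₀, ← hc'] at hc₀'
    exact one_ne_zero hc₀'
  have htrace : ∑ i, (d i : ℂ) * (ρ i (MonoidAlgebra.of ℂ G g)).trace = 0 := by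
    have h1 := trace_mulLeft_monoidAlgebra_of g
    rw [if_neg hg1, ← LinearMap.trace_conj' _ e.toLinearEquiv] at h1
    rw [← h1, ← trace_mulLeft_pi_matrix]
    congr 1
    refine LinearMap.ext fun a => ?_
    rw [LinearEquiv.conj_apply_apply, LinearMap.mulLeft_apply, LinearMap.mulLeft_apply]
    simp
    rfl
  rw [← Finset.add_sum_erase _ _ (Finset.mem_univ i₀), hi₀ g, Matrix.trace_one,
    Fintype.card_fin, hd₀] at htrace
  have hq0 : (q : ℂ) ≠ 0 := by exact_mod_cast hq.ne_zero
  have hpow : ∀ i, ρ i (MonoidAlgebra.of ℂ G g) ^ Nat.card G = 1 := fun i => by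
    rw [← map_pow, ← map_pow, pow_card_eq_one', map_one, map_one]
  have hsum : IsIntegral ℤ (∑ i ∈ Finset.univ.erase i₀,
      (d i : ℂ) * (ρ i (MonoidAlgebra.of ℂ G g)).trace / q) := by
    refine IsIntegral.sum _ fun i hi => ?_
    rcases key i with ⟨m, hm⟩ | h | h
    · have hm' : (d i : ℂ) = q * m := by exact_mod_cast hm
      rw [hm', mul_assoc, mul_div_cancel_left₀ _ hq0]
      exact (isIntegral_natCast m).mul (Matrix.isIntegral_trace_of_pow_eq_one Nat.card_pos (hpow i))
    · rw [h, mul_zero, zero_div]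
      exact isIntegral_zero
    · exact absurd (huniq i h) (Finset.ne_of_mem_erase hi)
  have hqint : IsIntegral ℤ ((algebraMap ℚ ℂ) (1 / q)) := by
    rw [← Finset.sum_div] at hsum
    have : (algebraMap ℚ ℂ) (1 / q) = -((∑ i ∈ Finset.univ.erase i₀,
      (d i : ℂ) * (ρ i (MonoidAlgebra.of ℂ G g)).trace) / q) := by
      rw [← neg_div, map_div₀, map_one, map_natCast]
      congr 1
      rw [Nat.cast_one, one_mul] at htrace
      linear_combination htrace
    rw [this]
    exact hsum.neg
  rw [isIntegral_algebraMap_iff (algebraMap ℚ ℂ).injective,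
    IsIntegrallyClosed.isIntegral_iff] at hqint
  obtain ⟨y, hy⟩ := hqint
  have hq0' : (q : ℚ) ≠ 0 := by exact_mod_cast hq.ne_zero
  have h1 : y * (q : ℤ) = 1 := by
    rw [eq_div_iff hq0'] at hy
    rw [eq_intCast] at hy
    exact_mod_cast hy
  have h2 : (q : ℤ) ∣ 1 := ⟨y, by rw [mul_comm, h1]⟩
  exact hq.one_lt.ne' (Nat.dvd_one.1 (by exact_mod_cast h2))

theorem card_conj_mul_card_centralizer {G : Type*} [Group G] [Finite G] (g : G) {C : Finset G}
    (hC : ∀ x, x ∈ C ↔ IsConj g x) :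
    C.card * Nat.card (Subgroup.centralizer {g}) = Nat.card G := by
  have h1 : (C : Set G) = MulAction.orbit (ConjAct G) g := by
    ext x
    rw [Finset.mem_coe, hC, ConjAct.mem_orbit_conjAct, isConj_comm]
  have h2 := Subgroup.card_mul_index (MulAction.stabilizer (ConjAct G) g)
  rw [MulAction.index_stabilizer, ← h1, Set.ncard_coe_finset] at h2
  rw [mul_comm]
  have h3 : Nat.card (MulAction.stabilizer (ConjAct G) g)
      = Nat.card (Subgroup.centralizer ({g} : Set G)) := by
    rw [ConjAct.stabilizer_eq_centralizer]
    rfl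
  rw [← h3]
  exact h2

theorem Nat.exists_eq_pow_mul_pow_of_dvd {p q a b d : ℕ} (hp : p.Prime) (hq : q.Prime)
    (h : d ∣ p ^ a * q ^ b) : ∃ a' b', d = p ^ a' * q ^ b' := by
  obtain ⟨x, y, hx, hy, rfl⟩ := (Nat.dvd_mul).1 h
  obtain ⟨i, -, rfl⟩ := (Nat.dvd_prime_pow hp).1 hx
  obtain ⟨j, -, rfl⟩ := (Nat.dvd_prime_pow hq).1 hy
  exact ⟨i, j, rfl⟩

theorem IsPGroup.isSolvable_of_finite {G : Type*} [Group G] [Finite G] {p : ℕ} (hp : p.Prime)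
    (hG : IsPGroup p G) : Group.IsSolvable G := by
  have := Fact.mk hp
  have := hG.isNilpotent
  infer_instance

theorem IsSimpleGroup.isSolvable_of_card_eq {G : Type*} [Group G] [Finite G] [IsSimpleGroup G]
    {p q a b : ℕ} (hp : p.Prime) (hq : q.Prime) (hcard : Nat.card G = p ^ a * q ^ b) :
    Group.IsSolvable G := by
  classical
  have := Fact.mk hp
  have := Fact.mk hq
  have := Fintype.ofFinite G
  rcases eq_or_ne p q with rfl | hpq
  · exact (IsPGroup.of_card (n := a + b) (by rw [hcard, pow_add])).isSolvable_of_finite hp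
  rcases Nat.eq_zero_or_pos a with rfl | ha
  · exact (IsPGroup.of_card (n := b) (by rw [hcard, pow_zero, one_mul])).isSolvable_of_finite hq
  have hcop : Nat.Coprime p q := (Nat.coprime_primes hp hq).2 hpq
  obtain ⟨P⟩ : Nonempty (Sylow p G) := inferInstance
  have hPcard : Nat.card P = p ^ a := by
    rw [Sylow.card_eq_multiplicity, hcard, Nat.factorization_mul (pow_pos hp.pos _).ne'
      (pow_pos hq.pos _).ne', Finsupp.add_apply, hp.factorization_pow, hq.factorization_pow]
    simp [hpq.symm]
  have hPnt : Nontrivial P := by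
    rw [← Finite.one_lt_card_iff_nontrivial, hPcard]
    exact Nat.one_lt_pow ha.ne' hp.one_lt
  have := P.2.center_nontrivial
  obtain ⟨z, hz⟩ := exists_ne (1 : Subgroup.center P)
  have hz1 : ((z : P) : G) ≠ 1 := fun h => hz (by ext; exact h)
  set g : G := ((z : P) : G) with hg
  set C : Finset G := Finset.univ.filter (IsConj g) with hCdef
  have hC : ∀ x, x ∈ C ↔ IsConj g x := by intro x; simp [hCdef]
  have h1 := card_conj_mul_card_centralizer g hC
  have hle : (P : Subgroup G) ≤ Subgroup.centralizer {g} := by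
    intro x hx
    rw [Subgroup.mem_centralizer_singleton_iff]
    have := Subgroup.mem_center_iff.1 z.2 ⟨x, hx⟩
    exact congrArg Subtype.val this
  have h2 : p ^ a ∣ Nat.card (Subgroup.centralizer {g}) := by
    rw [← hPcard]; exact Subgroup.card_dvd_of_le hle
  obtain ⟨c, hc⟩ := h2
  have h3 : C.card ∣ q ^ b := by
    refine ⟨c, ?_⟩
    have : p ^ a * q ^ b = p ^ a * (C.card * c) := by
      rw [← hcard, ← h1, hc]; ring
    exact Nat.eq_of_mul_eq_mul_left (pow_pos hp.pos _) this
  obtain ⟨k, -, hk⟩ := (Nat.dvd_prime_pow hq).1 h3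
  have hgc := IsSimpleGroup.mem_center_of_card_conj_eq_prime_pow hC hq hk
  have htop : Subgroup.center G = ⊤ := by
    rcases IsSimpleGroup.eq_bot_or_eq_top_of_normal (Subgroup.center G) inferInstance with h | h
    · exact absurd (by simpa [h] using hgc) hz1
    · exact h
  refine Group.isSolvable_of_comm fun x y => ?_
  have hx : x ∈ Subgroup.center G := htop ▸ Subgroup.mem_top x
  exact (Subgroup.mem_center_iff.1 hx y).symm

/-- **Burnside's theorem**: a group of order `p ^ a * q ^ b` is solvable. -/
theorem isSolvable_of_card_eq_prime_pow_mul_prime_pow {p q : ℕ} (hp : p.Prime) (hq : q.Prime)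
    (n : ℕ) : ∀ {G : Type*} [Group G] [Finite G] {a b : ℕ}, Nat.card G = n →
    n = p ^ a * q ^ b → Group.IsSolvable G := by
  induction n using Nat.strong_induction_on with
  | _ n ih =>
    intro G _ _ a b hn hcard
    rcases subsingleton_or_nontrivial G with hs | hnt
    · exact Group.isSolvable_of_comm fun x y => Subsingleton.elim _ _
    by_cases hN : ∃ N : Subgroup G, N.Normal ∧ N ≠ ⊥ ∧ N ≠ ⊤
    · obtain ⟨N, hNn, hNb, hNt⟩ := hN
      have hmul := Subgroup.card_eq_card_quotient_mul_card_subgroup N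
      have h1 : 1 < Nat.card N := Subgroup.one_lt_card_iff_ne_bot N |>.2 hNb
      have h2 : 1 < Nat.card (G ⧸ N) := by
        rcases Nat.lt_or_ge 1 (Nat.card (G ⧸ N)) with h | h
        · exact h
        · exfalso
          apply hNt
          rw [← Subgroup.index_eq_one]
          have : N.index ≠ 0 := Subgroup.index_ne_zero_of_finite
          have h' : N.index ≤ 1 := h
          omega
      obtain ⟨a1, b1, e1⟩ := Nat.exists_eq_pow_mul_pow_of_dvd (a := a) (b := b) hp hq
        (d := Nat.card N) (by rw [← hcard, ← hn, hmul]; exact dvd_mul_left _ _)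
      obtain ⟨a2, b2, e2⟩ := Nat.exists_eq_pow_mul_pow_of_dvd (a := a) (b := b) hp hq
        (d := Nat.card (G ⧸ N)) (by rw [← hcard, ← hn, hmul]; exact dvd_mul_right _ _)
      rw [Group.isSolvable_iff_subgroup_quotient N]
      refine ⟨ih _ ?_ rfl e1, ih _ ?_ rfl e2⟩
      · rw [← hn, hmul]; nlinarith
      · rw [← hn, hmul]; nlinarith
    · push Not at hN
      have : IsSimpleGroup G := ⟨fun N hNn => by
        by_cases h : N = ⊥
        · exact Or.inl h
        · exact Or.inr (hN N hNn h)⟩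
      exact IsSimpleGroup.isSolvable_of_card_eq hp hq (hn.trans hcard)

/-- A nontrivial finite solvable group has a nontrivial normal commutative subgroup. -/
theorem Group.IsSolvable.exists_normal_comm {G : Type*} [Group G] [Nontrivial G]
    (hG : Group.IsSolvable G) :
    ∃ A : Subgroup G, A.Normal ∧ A ≠ ⊥ ∧ ∀ x ∈ A, ∀ y ∈ A, x * y = y * x := by
  classical
  have hex := (Group.isSolvable_def G).1 hG
  have hpos : Nat.find hex ≠ 0 := by
    intro h0
    have := Nat.find_spec hex
    rw [h0, derivedSeries_zero] at this
    exact bot_ne_top this.symm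
  obtain ⟨n, hn⟩ := Nat.exists_eq_succ_of_ne_zero hpos
  refine ⟨derivedSeries G n, derivedSeries_normal G n, Nat.find_min hex (by omega), ?_⟩
  have h1 : derivedSeries G (n + 1) = ⊥ := by
    have := Nat.find_spec hex
    rwa [hn] at this
  intro x hx y hy
  rw [derivedSeries_succ, Subgroup.commutator_eq_bot_iff_le_centralizer] at h1
  exact (Subgroup.mem_centralizer_iff.1 (h1 hx) y hy).symm

theorem exists_normal_isPGroup_of_card {G : Type*} [Group G] [Finite G] [Nontrivial G]
    {p q a b : ℕ} (hp : p.Prime) (hq : q.Prime) (hcard : Nat.card G = p ^ a * q ^ b) :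
    ∃ N : Subgroup G, N.Normal ∧ N ≠ ⊥ ∧ (IsPGroup p N ∨ IsPGroup q N) := by
  obtain ⟨A, hAn, hAb, hAc⟩ :=
    (isSolvable_of_card_eq_prime_pow_mul_prime_pow hp hq _ rfl hcard).exists_normal_comm
  have h1 : Nat.card A ≠ 1 := ((Subgroup.one_lt_card_iff_ne_bot A).2 hAb).ne'
  obtain ⟨l, hl, hlA⟩ := Nat.exists_prime_and_dvd h1
  have hlpq : l = p ∨ l = q := by
    have : l ∣ p ^ a * q ^ b := hcard ▸ hlA.trans (Subgroup.card_subgroup_dvd_card A)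
    rcases (Nat.Prime.dvd_mul hl).1 this with h | h
    · exact Or.inl ((Nat.prime_dvd_prime_iff_eq hl hp).1 (hl.dvd_of_dvd_pow h))
    · exact Or.inr ((Nat.prime_dvd_prime_iff_eq hl hq).1 (hl.dvd_of_dvd_pow h))
  have := Fact.mk hl
  obtain ⟨S⟩ : Nonempty (Sylow l A) := inferInstance
  have hSn : (S : Subgroup A).Normal := ⟨fun x hx g => by
    have : g * x * g⁻¹ = x := by
      have := hAc g g.2 x x.2
      have h' : g * x = x * g := Subtype.ext this
      rw [h', mul_inv_cancel_right]
    rwa [this]⟩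
  have := Sylow.characteristic_of_normal S hSn
  refine ⟨(S : Subgroup A).map A.subtype, ConjAct.normal_of_characteristic_of_normal, ?_, ?_⟩
  · intro hbot
    have h2 : (S : Subgroup A) = ⊥ :=
      (Subgroup.map_eq_bot_iff_of_injective _ A.subtype_injective).1 hbot
    have h3 := S.ne_bot_of_dvd_card hlA
    exact h3 h2
  · have h4 : IsPGroup l ((S : Subgroup A).map A.subtype) := S.2.map _
    rcases hlpq with rfl | rfl
    · exact Or.inl h4
    · exact Or.inr h4

section BraceAction

theorem MulAction.eq_or_injective_of_equivariant {G X Y : Type*} [Group G] [MulAction G X]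
    [MulAction G Y] [MulAction.IsPreprimitive G X] {f : X → Y}
    (hf : ∀ (g : G) x, f (g • x) = g • f x) : (∀ x y, f x = f y) ∨ Function.Injective f := by
  by_cases h : Function.Injective f
  · exact Or.inr h
  left
  rw [Function.Injective] at h
  push Not at h
  obtain ⟨x, y, hxy, hne⟩ := h
  have hB : MulAction.IsBlock G (f ⁻¹' {f x}) := by
    rw [MulAction.isBlock_iff_smul_eq_of_mem]
    intro g a ha hga
    have ha' : f a = f x := ha
    have hga' : f (g • a) = f x := hga
    have hfix : g • f x = f x := by rw [← ha', ← hf, hga', ha']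
    ext z
    rw [Set.mem_smul_set_iff_inv_smul_mem, Set.mem_preimage, Set.mem_preimage,
      Set.mem_singleton_iff, Set.mem_singleton_iff, hf, inv_smul_eq_iff, hfix]
  rcases MulAction.IsPreprimitive.isTrivialBlock_of_isBlock hB with hs | hu
  · exact absurd (hs (show f x = f x from rfl) (show f y = f x from hxy.symm)) hne
  · have : ∀ z, f z = f x := fun z => by
      have : z ∈ f ⁻¹' {f x} := hu ▸ Set.mem_univ z
      exact this
    intro z w
    rw [this z, this w]

theorem MulAction.exists_smul_eq_of_normal {G X : Type*} [Group G] [MulAction G X]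
    [FaithfulSMul G X] [MulAction.IsPreprimitive G X] {N : Subgroup G} [N.Normal] (hN : N ≠ ⊥)
    (x y : X) : ∃ g ∈ N, g • x = y := by
  rcases MulAction.IsPreprimitive.isTrivialBlock_of_isBlock
    (MulAction.IsBlock.orbit_of_normal (G := G) (N := N) x) with hs | hu
  · exfalso
    apply hN
    rw [Subgroup.eq_bot_iff_forall]
    intro n hn
    refine eq_of_smul_eq_smul (α := X) fun z => ?_
    obtain ⟨g, rfl⟩ := MulAction.exists_smul_eq G x z
    have hc : g⁻¹ * n * g ∈ N := by
      have := ‹N.Normal›.conj_mem n hn g⁻¹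
      rwa [inv_inv] at this
    have h1 : (g⁻¹ * n * g) • x = x :=
      hs ⟨⟨_, hc⟩, rfl⟩ (MulAction.mem_orbit_self x)
    rw [one_smul]
    calc n • g • x = g • (g⁻¹ * n * g) • x := by
            rw [smul_smul, smul_smul]; congr 1; group
      _ = g • x := by rw [h1]
  · obtain ⟨⟨g, hg⟩, hgy⟩ := (hu ▸ Set.mem_univ y : y ∈ MulAction.orbit N x)
    exact ⟨g, hg, hgy⟩

theorem pow_eq_one_of_coprime {A : Type*} [Group A] {a : A} {D E : ℕ} (h : Nat.Coprime D E)
    (hD : a ^ D = 1) (hE : a ^ E = 1) : a = 1 := by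
  rw [← orderOf_eq_one_iff]
  exact Nat.eq_one_of_dvd_coprimes h (orderOf_dvd_of_pow_eq_one hD) (orderOf_dvd_of_pow_eq_one hE)

variable {G A : Type*} [Group G] [CommGroup A] [MulDistribMulAction G A]

/-- The image in `G` of the `m`-torsion of `A` under a map `π` that satisfies the identity of the
inverse of a 1-cocycle. -/
def torsionImage (π : A → G) (hπ : ∀ a b, π (a * π a • b) = π a * π b) (m : ℕ) : Subgroup G where
  carrier := π '' {a | a ^ m = 1}
  mul_mem' := by
    rintro _ _ ⟨a, ha, rfl⟩ ⟨b, hb, rfl⟩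
    refine ⟨a * π a • b, ?_, hπ a b⟩
    have ha' : a ^ m = 1 := ha
    have hb' : b ^ m = 1 := hb
    show (a * π a • b) ^ m = 1
    rw [mul_pow, ← smul_pow', ha', hb', smul_one, mul_one]
  one_mem' := by
    refine ⟨1, one_pow m, ?_⟩
    have := hπ 1 1
    rwa [smul_one, mul_one, left_eq_mul] at this
  inv_mem' := by
    rintro _ ⟨a, ha, rfl⟩
    have ha' : a ^ m = 1 := ha
    have h1 : π 1 = 1 := by
      have := hπ 1 1
      rwa [smul_one, mul_one, left_eq_mul] at this
    refine ⟨(π a)⁻¹ • a⁻¹, ?_, ?_⟩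
    · show ((π a)⁻¹ • a⁻¹) ^ m = 1
      rw [← smul_pow', inv_pow, ha', inv_one, smul_one]
    · have := hπ a ((π a)⁻¹ • a⁻¹)
      rw [smul_inv_smul, mul_inv_cancel, h1] at this
      exact eq_inv_of_mul_eq_one_right this.symm

theorem mem_torsionImage {π : A → G} {hπ : ∀ a b, π (a * π a • b) = π a * π b} {m : ℕ} {g : G} :
    g ∈ torsionImage π hπ m ↔ ∃ a, a ^ m = 1 ∧ π a = g := Iff.rfl

theorem card_torsionImage {π : A → G} {hπ : ∀ a b, π (a * π a • b) = π a * π b}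
    (hinj : Function.Injective π) (m : ℕ) :
    Nat.card (torsionImage π hπ m) = Nat.card (powMonoidHom m : A →* A).ker :=
  Nat.card_image_of_injective hinj (((powMonoidHom m : A →* A).ker : Subgroup A) : Set A)

theorem prime_dvd_of_dvd_card_torsion [Finite A] {m l : ℕ} (hl : l.Prime)
    (h : l ∣ Nat.card (powMonoidHom m : A →* A).ker) : l ∣ m := by
  have := Fact.mk hl
  obtain ⟨x, hx⟩ := exists_prime_orderOf_dvd_card' l h
  rw [← hx]
  apply orderOf_dvd_of_pow_eq_one
  exact Subtype.ext x.2

theorem isPGroup_torsionImage [Finite A] {π : A → G} {hπ : ∀ a b, π (a * π a • b) = π a * π b}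
    (hinj : Function.Injective π) {p : ℕ} (hp : p.Prime) (α : ℕ) :
    IsPGroup p (torsionImage π hπ (p ^ α)) := by
  refine IsPGroup.of_card (Nat.eq_prime_pow_of_unique_prime_dvd ?_ fun {d} hd h => ?_)
  · rw [card_torsionImage hinj]
    exact Nat.card_pos.ne'
  · rw [card_torsionImage hinj] at h
    exact (Nat.prime_dvd_prime_iff_eq hd hp).1
      (hd.dvd_of_dvd_pow (prime_dvd_of_dvd_card_torsion hd h))

theorem exists_card_eq_of_forall_prime_dvd {n p q : ℕ} (hn : n ≠ 0)
    (h : ∀ d, d.Prime → d ∣ n → d = p ∨ d = q) : ∃ a b, n = p ^ a * q ^ b := by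
  induction n using Nat.recOnMul with
  | zero => exact absurd rfl hn
  | one => exact ⟨0, 0, by simp⟩
  | prime l hl =>
    rcases h l hl dvd_rfl with rfl | rfl
    · exact ⟨1, 0, by simp⟩
    · exact ⟨0, 1, by simp⟩
  | mul a b iha ihb =>
    obtain ⟨i, j, hij⟩ := iha (left_ne_zero_of_mul hn) fun d hd hda => h d hd (hda.mul_right _)
    obtain ⟨k, l, hkl⟩ := ihb (right_ne_zero_of_mul hn) fun d hd hdb => h d hd (hdb.mul_left _)
    exact ⟨i + k, j + l, by rw [hij, hkl]; ring⟩

theorem not_dvd_index_torsionImage [Finite A] {π : A → G}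
    {hπ : ∀ a b, π (a * π a • b) = π a * π b}
    (hinj : Function.Injective π) {p : ℕ} (hp : p.Prime) {D E : ℕ} (hpE : ¬ p ∣ E) :
    ¬ p ∣ ((torsionImage π hπ D).subgroupOf (torsionImage π hπ (D * E))).index := by
  have := Fact.mk hp
  set f : A →* A := powMonoidHom D
  set F : A →* A := powMonoidHom (D * E)
  have hle : f.ker ≤ F.ker := by
    intro a ha
    have ha' : a ^ D = 1 := ha
    show a ^ (D * E) = 1
    rw [pow_mul, ha', one_pow]
  have hle' : torsionImage π hπ D ≤ torsionImage π hπ (D * E) := by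
    rintro _ ⟨a, ha, rfl⟩
    exact ⟨a, hle ha, rfl⟩
  have h1 := Subgroup.index_mul_card (f.ker.subgroupOf F.ker)
  have h2 := Subgroup.index_mul_card
    ((torsionImage π hπ D).subgroupOf (torsionImage π hπ (D * E)))
  rw [Nat.card_congr (Subgroup.subgroupOfEquivOfLe hle).toEquiv] at h1
  rw [Nat.card_congr (Subgroup.subgroupOfEquivOfLe hle').toEquiv, card_torsionImage hinj,
    card_torsionImage hinj, ← h1] at h2
  rw [Nat.eq_of_mul_eq_mul_right Nat.card_pos h2]
  have h3 : (f.ker.subgroupOf F.ker).index = Nat.card (F.ker.map f) := Subgroup.relIndex_ker _ _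
  rw [h3]
  intro hdvd
  obtain ⟨x, hx⟩ := exists_prime_orderOf_dvd_card' p hdvd
  apply hpE
  rw [← hx]
  apply orderOf_dvd_of_pow_eq_one
  obtain ⟨x, a, ha, rfl⟩ := x
  have ha' : a ^ (D * E) = 1 := ha
  refine Subtype.ext ?_
  show (a ^ D) ^ E = 1
  rw [← pow_mul, ha']

variable {X : Type*} [MulAction G X] [FaithfulSMul G X]

theorem eq_bot_of_isPGroup_of_normal [Finite A] {π : A → G}
    {hπ : ∀ a b, π (a * π a • b) = π a * π b} (hinj : Function.Injective π)
    {p : ℕ} (hp : p.Prime) {α E : ℕ} (hpE : ¬ p ∣ E)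
    {f : X → A} (hf : ∀ (g : G) x, f (g • x) = g • f x) (hfi : Function.Injective f)
    (hfE : ∀ x, f x ^ E = 1) {N : Subgroup (torsionImage π hπ (p ^ α * E))} (hN : N.Normal)
    (hNp : IsPGroup p N) : N = ⊥ := by
  have := Fact.mk hp
  have hle : torsionImage π hπ (p ^ α) ≤ torsionImage π hπ (p ^ α * E) := by
    rintro _ ⟨a, ha, rfl⟩
    have ha' : a ^ (p ^ α) = 1 := ha
    refine ⟨a, ?_, rfl⟩
    show a ^ (p ^ α * E) = 1
    rw [pow_mul, ha', one_pow]
  have hcop : Nat.Coprime (p ^ α) E :=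
    Nat.Coprime.pow_left _ ((Nat.Prime.coprime_iff_not_dvd hp).2 hpE)
  have hP : IsPGroup p ((torsionImage π hπ (p ^ α)).subgroupOf (torsionImage π hπ (p ^ α * E))) :=
    (isPGroup_torsionImage (hπ := hπ) hinj hp α).of_equiv (Subgroup.subgroupOfEquivOfLe hle).symm
  have hNle : N ≤ (torsionImage π hπ (p ^ α)).subgroupOf (torsionImage π hπ (p ^ α * E)) :=
    hNp.le_sylow_of_normal (hP.toSylow (not_dvd_index_torsionImage hinj hp hpE))
  rw [Subgroup.eq_bot_iff_forall]
  intro n hn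
  have key : ∀ c : A, c ^ E = 1 → (n : G) • c = c := by
    intro c hc
    have hcK : π c ∈ torsionImage π hπ (p ^ α * E) := by
      refine ⟨c, ?_, rfl⟩
      show c ^ (p ^ α * E) = 1
      rw [mul_comm, pow_mul, hc, one_pow]
    set g : torsionImage π hπ (p ^ α * E) := ⟨π c, hcK⟩
    have hn' : g⁻¹ * n * g ∈ N := by
      have := hN.conj_mem n hn g⁻¹
      rwa [inv_inv] at this
    obtain ⟨a, ha, han⟩ := hNle hn
    obtain ⟨b, hb, hbn⟩ := hNle hn'
    have ha' : a ^ (p ^ α) = 1 := ha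
    have hb' : b ^ (p ^ α) = 1 := hb
    have han' : π a = (n : G) := han
    have hbn' : π b = (π c)⁻¹ * n * π c := hbn
    have h1 : π (a * (n : G) • c) = π (c * π c • b) := by
      rw [← han', hπ, hπ, hbn', han']; group
    have h2 := hinj h1
    have h3 : ((n : G) • c) * c⁻¹ = a⁻¹ * π c • b := by
      rw [mul_inv_eq_iff_eq_mul, mul_assoc, eq_inv_mul_iff_mul_eq, h2, mul_comm]
    have h4 : ((n : G) • c) * c⁻¹ = 1 := by
      refine pow_eq_one_of_coprime hcop ?_ ?_
      · rw [h3, mul_pow, inv_pow, ha', ← smul_pow', hb', smul_one, inv_one, mul_one]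
      · rw [mul_pow, ← smul_pow', inv_pow, hc, smul_one, inv_one, mul_one]
    exact mul_inv_eq_one.1 h4
  refine Subtype.ext (eq_of_smul_eq_smul (α := X) fun x => ?_)
  apply hfi
  rw [hf, key _ (hfE x)]
  simp

theorem not_injective_of_prime_ne [Finite A] [Nontrivial X] {π : A → G}
    (hπ : ∀ a b, π (a * π a • b) = π a * π b) (hinj : Function.Injective π)
    {p q : ℕ} (hp : p.Prime) (hq : q.Prime) (hpq : p ≠ q) {α β : ℕ}
    {f₁ f₂ : X → A} (hf₁ : ∀ (g : G) x, f₁ (g • x) = g • f₁ x)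
    (hf₂ : ∀ (g : G) x, f₂ (g • x) = g • f₂ x) (hf₁p : ∀ x, f₁ x ^ p ^ α = 1)
    (hf₂q : ∀ x, f₂ x ^ q ^ β = 1) (hi₁ : Function.Injective f₁) :
    ¬ Function.Injective f₂ := by
  intro hi₂
  have hinjT : ∀ x, π (f₁ x) ∈ torsionImage π hπ (p ^ α * q ^ β) := fun x => by
    refine ⟨f₁ x, ?_, rfl⟩
    show f₁ x ^ (p ^ α * q ^ β) = 1
    rw [pow_mul, hf₁p, one_pow]
  have hnt : Nontrivial (torsionImage π hπ (p ^ α * q ^ β)) := by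
    obtain ⟨x, y, hxy⟩ := exists_pair_ne X
    refine ⟨⟨⟨_, hinjT x⟩, ⟨_, hinjT y⟩, fun h => hxy (hi₁ (hinj (congrArg Subtype.val h)))⟩⟩
  have hfin : Finite (torsionImage π hπ (p ^ α * q ^ β)) :=
    Set.Finite.image π (Set.toFinite _)
  obtain ⟨a, b, hab⟩ := exists_card_eq_of_forall_prime_dvd (p := p) (q := q)
    (n := Nat.card (torsionImage π hπ (p ^ α * q ^ β))) Nat.card_pos.ne' (by
      intro d hd h
      rw [card_torsionImage hinj] at h
      rcases (Nat.Prime.dvd_mul hd).1 (prime_dvd_of_dvd_card_torsion hd h) with h | h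
      · exact Or.inl ((Nat.prime_dvd_prime_iff_eq hd hp).1 (hd.dvd_of_dvd_pow h))
      · exact Or.inr ((Nat.prime_dvd_prime_iff_eq hd hq).1 (hd.dvd_of_dvd_pow h)))
  obtain ⟨N, hN, hNb, hNp | hNq⟩ := exists_normal_isPGroup_of_card hp hq hab
  · refine hNb (eq_bot_of_isPGroup_of_normal hinj hp ?_ hf₂ hi₂ hf₂q hN hNp)
    exact fun h => hpq ((Nat.prime_dvd_prime_iff_eq hp hq).1 (hp.dvd_of_dvd_pow h))
  · have hqp : ¬ q ∣ p ^ α := fun h =>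
      hpq ((Nat.prime_dvd_prime_iff_eq hq hp).1 (hq.dvd_of_dvd_pow h)).symm
    revert N
    rw [mul_comm (p ^ α)]
    intro N hN hNb hNq
    exact hNb (eq_bot_of_isPGroup_of_normal hinj hq hqp hf₁ hi₁ hf₁p hN hNq)

theorem not_injective_of_pow_eq [Finite A] [Finite G] [Nontrivial X]
    [MulAction.IsPreprimitive G X] {π : A → G}
    (hπ : ∀ a b, π (a * π a • b) = π a * π b) (hbij : Function.Bijective π)
    {p : ℕ} (hp : p.Prime) {α : ℕ}
    (hfix : ∀ (g : G) (a : A), g • a ^ p ^ α = a ^ p ^ α)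
    {f : X → A} (hf : ∀ (g : G) x, f (g • x) = g • f x)
    (hfp : ∀ x, f x ^ p ^ α = 1) : ¬ Function.Injective f := by
  intro hfi
  have := Fact.mk hp
  obtain ⟨x₀, x₁, hx⟩ := exists_pair_ne X
  set e := Equiv.ofBijective π hbij
  have hπe : ∀ g, π (e.symm g) = g := e.apply_symm_apply
  set φ : G →* A := MonoidHom.mk' (fun g => e.symm g ^ p ^ α) (fun g h => by
    have h1 : e.symm (g * h) = e.symm g * g • e.symm h := by
      rw [Equiv.symm_apply_eq]
      have := hπ (e.symm g) (e.symm h)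
      rw [hπe, hπe] at this
      exact this.symm
    rw [h1, mul_pow, ← hfix g (e.symm h), smul_pow']) with hφ
  set P := torsionImage π hπ (p ^ α) with hP
  have hker : φ.ker = P := by
    ext g
    rw [MonoidHom.mem_ker, mem_torsionImage]
    constructor
    · intro h
      exact ⟨e.symm g, h, hπe g⟩
    · rintro ⟨a, ha, rfl⟩
      show e.symm (e a) ^ p ^ α = 1
      rw [e.symm_apply_apply, ha]
  have hPn : P.Normal := hker ▸ MonoidHom.normal_ker φ
  have hPp : IsPGroup p P := isPGroup_torsionImage hbij.1 hp α
  have hmem : ∀ x, π (f x) ∈ P := fun x => ⟨f x, hfp x, rfl⟩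
  have hPnt : Nontrivial P :=
    ⟨⟨⟨_, hmem x₀⟩, ⟨_, hmem x₁⟩, fun h => hx (hfi (hbij.1 (congrArg Subtype.val h)))⟩⟩
  have hZnt := hPp.center_nontrivial
  have hZn : ((Subgroup.center P).map P.subtype).Normal :=
    ConjAct.normal_of_characteristic_of_normal
  have hZb : (Subgroup.center P).map P.subtype ≠ ⊥ := by
    intro h
    have h' := (Subgroup.map_eq_bot_iff_of_injective _ P.subtype_injective).1 h
    exact (Subgroup.nontrivial_iff_ne_bot _).1 hZnt h'
  have hfree : Function.Injective fun g : P => (g : G) • x₀ := by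
    intro g h hgh
    have hgh' : (g : G) • x₀ = (h : G) • x₀ := hgh
    refine Subtype.ext (eq_of_smul_eq_smul (α := X) fun y => ?_)
    obtain ⟨z, ⟨z, hz, rfl⟩, rfl⟩ := MulAction.exists_smul_eq_of_normal hZb x₀ y
    have hzc : ∀ k : P, (k : G) * z = z * k := fun k =>
      congrArg Subtype.val (Subgroup.mem_center_iff.1 hz k)
    show (g : G) • (z : G) • x₀ = (h : G) • (z : G) • x₀
    rw [smul_smul, smul_smul, hzc, hzc, mul_smul, mul_smul, hgh']
  have hXfin : Finite X := Finite.of_injective f hfi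
  have hcard : Nat.card (powMonoidHom (p ^ α) : A →* A).ker ≤ Nat.card X := by
    rw [← card_torsionImage (hπ := hπ) hbij.1]
    exact Nat.card_le_card_of_injective _ hfree
  set F : X → (powMonoidHom (p ^ α) : A →* A).ker := fun x => ⟨f x, hfp x⟩ with hF
  have hFi : Function.Injective F := fun x y h => hfi (congrArg Subtype.val h)
  have hFs : Function.Bijective F :=
    (Nat.bijective_iff_injective_and_card F).2
      ⟨hFi, le_antisymm (Nat.card_le_card_of_injective F hFi) hcard⟩
  obtain ⟨x, hx1⟩ := hFs.2 1
  have hfx : f x = 1 := congrArg Subtype.val hx1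
  have hall : ∀ y, y = x := by
    intro y
    obtain ⟨g, rfl⟩ := MulAction.exists_smul_eq G x y
    apply hfi
    rw [hf, hfx, smul_one]
  exact hx ((hall x₀).trans (hall x₁).symm)

theorem eq_of_equivariant_of_closure_eq_top [Finite A] [Finite G] [Nontrivial X]
    [MulAction.IsPreprimitive G X] {π : A → G}
    (hπ : ∀ a b, π (a * π a • b) = π a * π b) (hbij : Function.Bijective π)
    {t : X → A} (ht : ∀ (g : G) x, t (g • x) = g • t x)
    (htop : Subgroup.closure (Set.range t) = ⊤) (x y : X) : t x = t y := by
  set n := Nat.card A with hn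
  have hn0 : n ≠ 0 := Nat.card_pos.ne'
  have hpow : ∀ (m : ℕ) (g : G) x, t (g • x) ^ m = g • t x ^ m := fun m g x => by
    rw [ht, smul_pow']
  have htor : ∀ (p : ℕ) (a : A), (a ^ (n / p ^ n.factorization p)) ^ p ^ n.factorization p = 1 := by
    intro p a
    rw [← pow_mul, mul_comm, Nat.ordProj_mul_ordCompl_eq_self, hn, pow_card_eq_one']
  have hdich : ∀ m : ℕ, (∀ x y, t x ^ m = t y ^ m) ∨ Function.Injective fun x => t x ^ m :=
    fun m => MulAction.eq_or_injective_of_equivariant (hpow m)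
  have htriv : ∀ a : A, (∀ p : ℕ, p.Prime → a ^ (n / p ^ n.factorization p) = 1) → a = 1 := by
    intro a ha
    rw [← orderOf_eq_one_iff]
    by_contra hne
    obtain ⟨p, hp, hpa⟩ := Nat.exists_prime_and_dvd hne
    exact Nat.not_dvd_ordCompl hp hn0 (hpa.trans (orderOf_dvd_of_pow_eq_one (ha p hp)))
  have hconst : ∀ m : ℕ, (∀ x y, t x ^ m = t y ^ m) → (t x / t y) ^ m = 1 := fun m h => by
    rw [div_pow, h x y, div_self']
  by_cases hall : ∃ p : ℕ, p.Prime ∧ Function.Injective fun x => t x ^ (n / p ^ n.factorization p)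
  · exfalso
    obtain ⟨p, hp, hpi⟩ := hall
    have hother : ∀ q : ℕ, q.Prime → q ≠ p → ∀ x y,
        t x ^ (n / q ^ n.factorization q) = t y ^ (n / q ^ n.factorization q) := by
      intro q hq hqp
      refine (hdich _).resolve_right ?_
      exact not_injective_of_prime_ne hπ hbij.1 hp hq hqp.symm (hpow _) (hpow _)
        (fun x => htor p _) (fun x => htor q _) hpi
    have hD : ∀ x y, t x ^ p ^ n.factorization p = t y ^ p ^ n.factorization p := by
      intro x y
      rw [← div_eq_one, ← div_pow]
      refine htriv _ fun q hq => ?_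
      by_cases hqp : q = p
      · subst hqp
        rw [← pow_mul, mul_comm, pow_mul]
        exact htor q _
      · rw [← pow_mul, mul_comm, pow_mul, div_pow (t x), hother q hq hqp x y, div_self', one_pow]
    have hfix : ∀ (g : G) (a : A),
        g • a ^ p ^ n.factorization p = a ^ p ^ n.factorization p := by
      intro g a
      have ha : a ∈ Subgroup.closure (Set.range t) := htop ▸ Subgroup.mem_top a
      induction ha using Subgroup.closure_induction with
      | mem a h =>
        obtain ⟨z, rfl⟩ := h
        rw [← hpow, hD]
      | one => rw [one_pow, smul_one]
      | mul a b _ _ iha ihb => rw [mul_pow, smul_mul', iha, ihb]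
      | inv a _ iha => rw [inv_pow, smul_inv', iha]
    exact not_injective_of_pow_eq hπ hbij hp hfix (hpow _) (fun x => htor p _) hpi
  · push Not at hall
    rw [← div_eq_one]
    exact htriv _ fun p hp => hconst _ ((hdich _).resolve_right (hall p hp))

end BraceAction

section CycleSet

variable {G X : Type*} [Group G] [MulAction G X]

/-- The permutation `g ↦ g * s (g⁻¹ • y)` of `G`. -/
noncomputable def translationPerm [Finite G] {s : X → G}
    (hT : Function.Injective fun x => (s x)⁻¹ • x) (y : X) : Equiv.Perm G :=
  Equiv.ofBijective (fun g => g * s (g⁻¹ • y)) (Finite.injective_iff_bijective.1 (by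
    intro g k hgk
    have hgk' : g * s (g⁻¹ • y) = k * s (k⁻¹ • y) := hgk
    have h1 : (g⁻¹ • y : X) = k⁻¹ • y := by
      apply hT
      show (s (g⁻¹ • y))⁻¹ • g⁻¹ • y = (s (k⁻¹ • y))⁻¹ • k⁻¹ • y
      rw [smul_smul, smul_smul, ← mul_inv_rev, ← mul_inv_rev, hgk']
    rw [h1] at hgk'
    exact mul_right_cancel hgk'))

variable [Finite G] {s : X → G} (hT : Function.Injective fun x => (s x)⁻¹ • x)

theorem translationPerm_apply (y : X) (g : G) : translationPerm hT y g = g * s (g⁻¹ • y) := rfl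

theorem translationPerm_comm (hs : ∀ u w, s u * s ((s u)⁻¹ • w) = s w * s ((s w)⁻¹ • u))
    (u w : X) :
    translationPerm hT u * translationPerm hT w = translationPerm hT w * translationPerm hT u := by
  ext g
  simp only [Equiv.Perm.mul_apply, translationPerm_apply, mul_inv_rev, mul_smul, mul_assoc]
  rw [hs]

theorem conj_translationPerm (g : G) (y : X) :
    MulAut.conj (MulAction.toPermHom G G g) (translationPerm hT y)
      = translationPerm hT (g • y) := by
  ext k
  simp [MulAut.conj_apply, Equiv.Perm.mul_apply, translationPerm_apply, mul_smul, mul_assoc]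

/-- Left multiplication of `G` on itself induces by conjugation an action of `G` on the group
generated by the permutations `translationPerm hT y`. -/
@[reducible] noncomputable def translationAction : MulDistribMulAction G
    (Subgroup.closure (Set.range (translationPerm hT))) where
  smul g a := ⟨MulAut.conj (MulAction.toPermHom G G g) a, by
    obtain ⟨a, ha⟩ := a
    induction ha using Subgroup.closure_induction with
    | mem a h =>
      obtain ⟨z, rfl⟩ := h
      rw [conj_translationPerm]
      exact Subgroup.subset_closure ⟨_, rfl⟩
    | one => rw [map_one]; exact one_mem _
    | mul a b _ _ iha ihb => rw [map_mul]; exact mul_mem iha ihb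
    | inv a _ iha => rw [map_inv]; exact inv_mem iha⟩
  one_smul a := Subtype.ext (by
    show MulAut.conj (MulAction.toPermHom G G 1) (a : Equiv.Perm G) = a
    rw [map_one, map_one, MulAut.one_apply])
  mul_smul g k a := Subtype.ext (by
    show MulAut.conj (MulAction.toPermHom G G (g * k)) (a : Equiv.Perm G) = _
    rw [map_mul, map_mul, MulAut.mul_apply]
    rfl)
  smul_one g := Subtype.ext (map_one (MulAut.conj (MulAction.toPermHom G G g)))
  smul_mul g a b := Subtype.ext (map_mul (MulAut.conj (MulAction.toPermHom G G g)) _ _)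

theorem eq_of_isPreprimitive [FaithfulSMul G X] [Nontrivial X] [MulAction.IsPreprimitive G X]
    (hT : Function.Injective fun x => (s x)⁻¹ • x)
    (hs : ∀ u w, s u * s ((s u)⁻¹ • w) = s w * s ((s w)⁻¹ • u))
    (htop : Subgroup.closure (Set.range s) = ⊤) (x y : X) : s x = s y := by
  let A := Subgroup.closure (Set.range (translationPerm hT))
  have hA : IsMulCommutative A := Subgroup.isMulCommutative_closure (by
    rintro _ ⟨u, rfl⟩ _ ⟨w, rfl⟩
    exact translationPerm_comm hT hs u w)
  let : CommGroup A := { (inferInstance : Group A) with mul_comm := hA.is_comm.comm }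
  let : MulDistribMulAction G A := translationAction hT
  let t : X → A := fun y => ⟨translationPerm hT y, Subgroup.subset_closure ⟨y, rfl⟩⟩
  let π : A → G := fun a => (a : Equiv.Perm G) 1
  have ht : ∀ (g : G) x, t (g • x) = g • t x := fun g x =>
    Subtype.ext (conj_translationPerm hT g x).symm
  have hcomm : ∀ (a b : A) (g : G),
      (a : Equiv.Perm G) ((b : Equiv.Perm G) g) = (b : Equiv.Perm G) ((a : Equiv.Perm G) g) :=
    fun a b g => congrArg (fun c : A => (c : Equiv.Perm G) g) (mul_comm a b)
  have hπ : ∀ a b, π (a * π a • b) = π a * π b := by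
    intro a b
    rw [mul_comm]
    show π a * (b : Equiv.Perm G) ((π a)⁻¹ * π a) = π a * π b
    rw [inv_mul_cancel]
  have hπt : ∀ x, π (t x) = s x := fun x => by
    show 1 * s ((1 : G)⁻¹ • x) = s x
    rw [one_mul, inv_one, one_smul]
  have hsurj : Function.Surjective π := by
    have h1 : torsionImage π hπ 0 = ⊤ := by
      rw [eq_top_iff, ← htop, Subgroup.closure_le]
      rintro _ ⟨x, rfl⟩
      exact ⟨t x, pow_zero _, hπt x⟩
    intro g
    obtain ⟨a, -, ha⟩ := (h1 ▸ Subgroup.mem_top g : g ∈ torsionImage π hπ 0)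
    exact ⟨a, ha⟩
  have hinj : Function.Injective π := by
    intro a b hab
    refine Subtype.ext (Equiv.ext fun g => ?_)
    obtain ⟨c, rfl⟩ := hsurj g
    show (a : Equiv.Perm G) ((c : Equiv.Perm G) 1) = (b : Equiv.Perm G) ((c : Equiv.Perm G) 1)
    rw [hcomm, hcomm b c]
    exact congrArg _ hab
  have htop' : Subgroup.closure (Set.range t) = ⊤ := by
    have h1 : Set.range t = ((↑) : A → Equiv.Perm G) ⁻¹' Set.range (translationPerm hT) := by
      ext a
      constructor
      · rintro ⟨y, rfl⟩
        exact ⟨y, rfl⟩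
      · rintro ⟨y, hy⟩
        exact ⟨y, Subtype.ext hy⟩
    rw [h1]
    exact Subgroup.closure_closure_coe_preimage
  rw [← hπt x, ← hπt y, eq_of_equivariant_of_closure_eq_top hπ ⟨hinj, hsurj⟩ ht htop' x y]

end CycleSet

section Solution

variable {X : Type*} {r : X × X → X × X}

theorem r_eq (h : IsYBSolution r) (x y : X) :
    r (x, y) = (sigmaPerm r h x y, (sigmaPerm r h (sigmaPerm r h x y))⁻¹ x) := by
  refine Prod.ext rfl ?_
  rw [Equiv.Perm.eq_inv_iff_eq]
  exact congrArg Prod.fst (h.1 (x, y))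

theorem sigmaPerm_mul_sigmaPerm (h : IsYBSolution r) (x y : X) :
    sigmaPerm r h x * sigmaPerm r h y
      = sigmaPerm r h (sigmaPerm r h x y)
        * sigmaPerm r h ((sigmaPerm r h (sigmaPerm r h x y))⁻¹ x) := by
  ext z
  have h1 := congrArg Prod.fst (congrFun h.2.2.2 (x, y, z))
  simp only [Function.comp_apply, rMap12, rMap23] at h1
  rw [r_eq h x y] at h1
  exact h1.symm

theorem sigmaPerm_cycle_identity (h : IsYBSolution r) (u w : X) :
    sigmaPerm r h u * sigmaPerm r h ((sigmaPerm r h u)⁻¹ w)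
      = sigmaPerm r h w * sigmaPerm r h ((sigmaPerm r h w)⁻¹ u) := by
  rw [sigmaPerm_mul_sigmaPerm,
    show sigmaPerm r h u ((sigmaPerm r h u)⁻¹ w) = w from Equiv.apply_symm_apply _ _]

theorem injective_sigmaPerm_inv_apply (h : IsYBSolution r) :
    Function.Injective fun x => (sigmaPerm r h x)⁻¹ x := by
  have key : ∀ x, gammaMap r ((sigmaPerm r h x)⁻¹ x) x = (sigmaPerm r h x)⁻¹ x := fun x => by
    show (r (x, (sigmaPerm r h x)⁻¹ x)).2 = _
    rw [r_eq h, show sigmaPerm r h x ((sigmaPerm r h x)⁻¹ x) = x from Equiv.apply_symm_apply _ _]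
  intro x y hxy
  have hxy' : (sigmaPerm r h x)⁻¹ x = (sigmaPerm r h y)⁻¹ y := hxy
  apply (h.2.2.1 ((sigmaPerm r h x)⁻¹ x)).1
  rw [key x]
  conv_rhs => rw [hxy', key y]
  exact hxy'

theorem sigmaPerm_eq_sigmaPerm [Finite X] [Nontrivial X] (h : IsYBSolution r)
    (hprim : IsPrimitiveSolution r h) (x y : X) : sigmaPerm r h x = sigmaPerm r h y := by
  have := hprim.1
  have : MulAction.IsPreprimitive (permGroup r h) X := ⟨fun {B} => hprim.2 B⟩
  let s : X → permGroup r h := fun x => ⟨sigmaPerm r h x, Subgroup.subset_closure ⟨x, rfl⟩⟩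
  have htop : Subgroup.closure (Set.range s) = ⊤ := by
    have h1 : Set.range s = ((↑) : permGroup r h → Equiv.Perm X) ⁻¹'
        Set.range (sigmaPerm r h) := by
      ext a
      constructor
      · rintro ⟨y, rfl⟩
        exact ⟨y, rfl⟩
      · rintro ⟨y, hy⟩
        exact ⟨y, Subtype.ext hy⟩
    rw [h1]
    exact Subgroup.closure_closure_coe_preimage
  exact congrArg Subtype.val (eq_of_isPreprimitive (s := s) (injective_sigmaPerm_inv_apply h)
    (fun u w => Subtype.ext (sigmaPerm_cycle_identity h u w)) htop x y)

end Solution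

theorem Equiv.Perm.isCycle_and_card_support_of_forall_sameCycle {X : Type*} [Fintype X]
    [DecidableEq X] (hX : 1 < Fintype.card X) {f : Equiv.Perm X} (hf : ∀ x y, f.SameCycle x y) :
    f.IsCycle ∧ f.support.card = Fintype.card X := by
  have := Fintype.one_lt_card_iff_nontrivial.1 hX
  have hne : ∀ x, f x ≠ x := by
    intro x hx
    obtain ⟨y, hy⟩ := exists_ne x
    obtain ⟨i, hi⟩ := hf x y
    exact hy (by rw [← hi, Equiv.Perm.zpow_apply_eq_self_of_apply_eq_self hx])
  obtain ⟨x⟩ := this.to_nonempty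
  refine ⟨⟨x, hne x, fun y _ => hf x y⟩, ?_⟩
  rw [← Finset.card_univ]
  congr 1
  ext y
  simp [hne]

/-- for a finite primitive solution `(X,r)` of the YBE with `|X| > 1`,
all the permutations `σ_x` coincide, each `σ_x` is a cycle of length `|X|`, and
`(X,r)` is the permutation solution `r(x,y) = (σ(y), σ⁻¹(x))` determined by this
cycle. -/
theorem primitive_solution_is_cyclic_permutation_solution {X : Type*} [Fintype X]
    [DecidableEq X] (r : X × X → X × X) (h : IsYBSolution r)
    (hprim : IsPrimitiveSolution r h) (hX : 1 < Fintype.card X) :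
    (∀ x y : X, sigmaPerm r h x = sigmaPerm r h y) ∧
    (∀ x : X, (sigmaPerm r h x).IsCycle ∧ (sigmaPerm r h x).support.card = Fintype.card X) ∧
    (∀ x y : X, r (x, y) = (sigmaPerm r h x y, (sigmaPerm r h x)⁻¹ x)) := by
  have := Fintype.one_lt_card_iff_nontrivial.1 hX
  have heq := sigmaPerm_eq_sigmaPerm h hprim
  refine ⟨heq, fun x => ?_, fun x y => ?_⟩
  · refine Equiv.Perm.isCycle_and_card_support_of_forall_sameCycle hX fun y z => ?_
    have := hprim.1
    obtain ⟨⟨g, hg⟩, hgz⟩ := MulAction.exists_smul_eq (permGroup r h) y z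
    have hr : Set.range (sigmaPerm r h) = {sigmaPerm r h x} := by
      ext f
      constructor
      · rintro ⟨w, rfl⟩
        exact heq w x
      · rintro rfl
        exact ⟨x, rfl⟩
    rw [permGroup, hr, Subgroup.mem_closure_singleton] at hg
    obtain ⟨i, rfl⟩ := hg
    exact ⟨i, hgz⟩
  · rw [r_eq h x y, heq (sigmaPerm r h x y) x]
end
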